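/- Let Γ be a countably infinite group. There exist a free continuous action α of Γ on a Polish space X and a subshift Ω ⊆ ℕ^Γ such that the shift action of Γ on ℕ^Γ admits a Baire measurable Ω-coloring, while α does not admit a Baire measurable Ω-coloring. -/

import Mathlib

open Set Function Topology

namespace DescColor

/-- A set is *Baire measurable* if it differs from an open set by a meager set. -/
def BaireMSet {X : Type*} [TopologicalSpace X] (S : Set X) : Prop :=
  ∃ U : Set X, IsOpen U ∧ IsMeagre (symmDiff S U)

/-- A function is *Baire measurable* if preimages of measurable (Borel) sets are
Baire measurable. -/
def BaireMFun {X Y : Type*} [TopologicalSpace X] [MeasurableSpace Y] (f : X → Y) : Prop :=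
  ∀ B : Set Y, MeasurableSet B → BaireMSet (f ⁻¹' B)

variable {Γ : Type*}

/-- The shift action of `Γ` on colorings `Γ → ℕ`: `(γ · ω)(δ) = ω (δ γ)`. -/
def shift [Group Γ] (γ : Γ) (ω : Γ → ℕ) : Γ → ℕ := fun δ => ω (δ * γ)

/-- A subshift: a closed shift-invariant set of colorings. -/
def IsSubshift [Group Γ] (Ω : Set (Γ → ℕ)) : Prop :=
  IsClosed Ω ∧ ∀ (γ : Γ), ∀ ω ∈ Ω, shift γ ω ∈ Ω

/-- The coding map `π_f(x)(γ) = f (γ • x)`. -/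
def codingMap [Group Γ] {X : Type*} [MulAction Γ X] (f : X → ℕ) (x : X) : Γ → ℕ :=
  fun γ => f (γ • x)

/-- The action of `Γ` on `X` admits a Baire measurable `Ω`-coloring. -/
def HasBMColoring [Group Γ] (X : Type*) [TopologicalSpace X] [MulAction Γ X]
    (Ω : Set (Γ → ℕ)) : Prop :=
  ∃ f : X → ℕ, BaireMFun f ∧ {x : X | codingMap f x ∈ Ω} ∈ residual X

/-- The action of `Γ` on `X` is generically smooth. -/
def GenSmooth (Γ : Type*) [Group Γ] (X : Type*) [TopologicalSpace X] [MulAction Γ X] : Prop :=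
  ∃ f : X → ℝ, BaireMFun f ∧ ∀ x y : X, f x = f y ↔ ∃ γ : Γ, γ • x = y

/-- The shift action of `Γ` on `ℕ^Γ` admits a Baire measurable `Ω`-coloring. -/
def ShiftHasBMColoring (Γ : Type*) [Group Γ] (Ω : Set (Γ → ℕ)) : Prop :=
  ∃ f : (Γ → ℕ) → ℕ, BaireMFun f ∧
    {ω : Γ → ℕ | (fun γ : Γ => f (shift γ ω)) ∈ Ω} ∈ residual (Γ → ℕ)

/-- A free continuous action of `Γ` on a Polish space. -/
structure FreePolishAction (Γ : Type*) [Group Γ] where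
  X : Type
  ts : TopologicalSpace X
  polish : @PolishSpace X ts
  smul : Γ → X → X
  one_smul' : ∀ x, smul 1 x = x
  mul_smul' : ∀ γ δ x, smul (γ * δ) x = smul γ (smul δ x)
  cont : ∀ γ : Γ, @Continuous X X ts ts (smul γ)
  free : ∀ (γ : Γ) (x : X), smul γ x = x → γ = 1

/-- A free continuous action on a Polish space admits a Baire measurable `Ω`-coloring. -/
def FreePolishAction.HasBMCol [Group Γ] (α : FreePolishAction Γ) (Ω : Set (Γ → ℕ)) : Prop :=
  letI := α.ts
  ∃ f : α.X → ℕ, BaireMFun f ∧ {x : α.X | (fun γ : Γ => f (α.smul γ x)) ∈ Ω} ∈ residual α.X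

/-- A free continuous action on a Polish space is generically smooth. -/
def FreePolishAction.IsGenSmooth [Group Γ] (α : FreePolishAction Γ) : Prop :=
  letI := α.ts
  ∃ f : α.X → ℝ, BaireMFun f ∧ ∀ x y : α.X, f x = f y ↔ ∃ γ : Γ, α.smul γ x = y

/-- A subshift is *hard* if every free continuous action of `Γ` on a Polish space that
admits a Baire measurable `Ω`-coloring is generically smooth. -/
def Hard (Γ : Type*) [Group Γ] (Ω : Set (Γ → ℕ)) : Prop :=
  ∀ α : FreePolishAction Γ, α.HasBMCol Ω → α.IsGenSmooth

/-- A subshift is *easy* if every free continuous action of `Γ` on a Polish space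
admits a Baire measurable `Ω`-coloring. -/
def Easy (Γ : Type*) [Group Γ] (Ω : Set (Γ → ℕ)) : Prop :=
  ∀ α : FreePolishAction Γ, α.HasBMCol Ω

/-- Finite partial colorings of `Γ`: partial maps `Γ ⇀ ℕ` with finite domain. -/
abbrev FPC (Γ : Type*) : Type _ := {φ : Γ → Option ℕ // {γ : Γ | φ γ ≠ none}.Finite}

/-- The domain of a finite partial coloring. -/
def domP (φ : FPC Γ) : Set Γ := {γ : Γ | φ.1 γ ≠ none}

/-- `Fin(Ω)`: the set of finite partial colorings extending to an element of `Ω`. -/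
def FinOf (Ω : Set (Γ → ℕ)) : Set (FPC Γ) :=
  {φ | ∃ ω ∈ Ω, ∀ (γ : Γ) (c : ℕ), φ.1 γ = some c → ω γ = c}

/-- `g : FPC Γ → Bool` codes (the set `Fin(Ω)` of) the subshift `Ω`. -/
def CodesSubshift [Group Γ] (g : FPC Γ → Bool) (Ω : Set (Γ → ℕ)) : Prop :=
  IsSubshift Ω ∧ ∀ φ : FPC Γ, g φ = true ↔ φ ∈ FinOf Ω

/-- The shift action of `Γ` on finite partial colorings: `(γ · φ)(δ) = φ(δγ)`. -/
def shiftP [Group Γ] (γ : Γ) (φ : FPC Γ) : FPC Γ :=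
  ⟨fun δ => φ.1 (δ * γ), by
    apply (φ.2.image fun δ => δ * γ⁻¹).subset
    intro δ hδ
    exact ⟨δ * γ, hδ, by simp⟩⟩

/-- The empty partial coloring. -/
def emptyP (Γ : Type*) : FPC Γ := ⟨fun _ => none, by simp⟩

/-- The union (join) of two partial colorings (values of `φ` take precedence). -/
def joinP (φ ψ : FPC Γ) : FPC Γ :=
  ⟨fun δ => match φ.1 δ with | some c => some c | none => ψ.1 δ, by
    apply (φ.2.union ψ.2).subset
    intro δ hδ
    by_cases h : φ.1 δ = none
    · right
      simp only [mem_setOf_eq, h] at hδ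
      exact hδ
    · exact Or.inl h⟩

/-- The union of a finite list of partial colorings. -/
def joinList (l : List (FPC Γ)) : FPC Γ := l.foldr joinP (emptyP Γ)

/-- `φ[γ, r]`: the restriction of `φ` to the closed ball `B(γ, r)`. -/
noncomputable def restrictBall [MetricSpace Γ] (φ : FPC Γ) (γ : Γ) (r : ℝ) : FPC Γ :=
  ⟨fun δ => if dist γ δ ≤ r then φ.1 δ else none, by
    apply φ.2.subset
    intro δ hδ
    by_cases h : dist γ δ ≤ r
    · simp only [mem_setOf_eq, if_pos h] at hδ
      exact hδ
    · simp only [mem_setOf_eq, if_neg h] at hδ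
      exact absurd rfl hδ⟩

/-- `φ ∪ {(γ, c)}`. -/
def insertP [DecidableEq Γ] (φ : FPC Γ) (γ : Γ) (c : ℕ) : FPC Γ :=
  ⟨fun δ => if δ = γ then some c else φ.1 δ, by
    apply (φ.2.insert γ).subset
    intro δ hδ
    by_cases h : δ = γ
    · exact Or.inl h
    · right
      simp only [mem_setOf_eq, if_neg h] at hδ
      exact hδ⟩

/-- The restriction of a total coloring `ω` to a finite set `S`. -/
def restrictTo [DecidableEq Γ] (ω : Γ → ℕ) (S : Finset Γ) : FPC Γ :=
  ⟨fun δ => if δ ∈ S then some (ω δ) else none, by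
    apply S.finite_toSet.subset
    intro δ hδ
    by_cases h : δ ∈ S
    · exact h
    · simp only [mem_setOf_eq, if_neg h] at hδ
      exact absurd rfl hδ⟩

/-- Post-composition of a partial coloring with `ρ : ℕ → ℕ`. -/
def mapP (ρ : ℕ → ℕ) (φ : FPC Γ) : FPC Γ :=
  ⟨fun δ => (φ.1 δ).map ρ, by
    apply φ.2.subset
    intro δ hδ
    intro h
    simp only [mem_setOf_eq, h] at hδ
    exact hδ rfl⟩

/-- `ψ` is a restriction of `φ`. -/
def IsRestrictionOf (ψ φ : FPC Γ) : Prop := ∀ δ : Γ, ψ.1 δ = none ∨ ψ.1 δ = φ.1 δ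

/-- A `Γ`-ideal: a shift-invariant set of finite partial colorings closed under
restrictions. -/
def IsGammaIdeal [Group Γ] (P : Set (FPC Γ)) : Prop :=
  (∀ (γ : Γ), ∀ φ ∈ P, shiftP γ φ ∈ P) ∧
  (∀ φ ∈ P, ∀ ψ : FPC Γ, IsRestrictionOf ψ φ → ψ ∈ P)

/-- An extendable `Γ`-ideal. -/
def IsExtendable [DecidableEq Γ] (P : Set (FPC Γ)) : Prop :=
  ∀ φ ∈ P, ∀ γ : Γ, φ.1 γ = none → ∃ c : ℕ, insertP φ γ c ∈ P

/-- `φ` and `ψ` are `R`-separated: `dist(dom φ, dom ψ) > R φ + R ψ`. -/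
def RSeparated [MetricSpace Γ] (R : FPC Γ → ℝ) (φ ψ : FPC Γ) : Prop :=
  ∀ γ ∈ domP φ, ∀ δ ∈ domP ψ, R φ + R ψ < dist γ δ

/-- The join property of a `Γ`-ideal `P`. -/
def HasJoinProperty [Group Γ] [MetricSpace Γ] (P : Set (FPC Γ)) : Prop :=
  ∃ R : FPC Γ → ℝ, (∀ φ, 0 ≤ R φ) ∧ (∀ (γ : Γ), ∀ φ ∈ P, R (shiftP γ φ) = R φ) ∧
    ∀ l : List (FPC Γ), (∀ φ ∈ l, φ ∈ P) → l.Pairwise (RSeparated R) → joinList l ∈ P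

/-- `P^loc_r`: partial colorings that are `r`-locally in `P`. -/
def LocallyIn [MetricSpace Γ] (P : Set (FPC Γ)) (r : ℕ → ℝ) : Set (FPC Γ) :=
  {φ | ∀ (γ : Γ) (c : ℕ), φ.1 γ = some c → restrictBall φ γ (r c) ∈ P}

/-- A local `Γ`-ideal. -/
def IsLocal [MetricSpace Γ] (P : Set (FPC Γ)) : Prop :=
  ∃ r : ℕ → ℝ, (∀ c, 0 ≤ r c) ∧ P = LocallyIn P r

/-- `Col(P)`: colorings all of whose finite restrictions lie in `P`. -/
def ColOf [DecidableEq Γ] (P : Set (FPC Γ)) : Set (Γ → ℕ) :=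
  {ω | ∀ S : Finset Γ, restrictTo ω S ∈ P}

/-! ### The space of Baire measurable functions -/

/-- Baire measurable functions from `X` to `Y`. -/
abbrev BMFunSub (X Y : Type*) [TopologicalSpace X] [MeasurableSpace Y] :=
  {f : X → Y // BaireMFun f}

/-- Equality on a comeager set. -/
def BFunRel {X Y : Type*} [TopologicalSpace X] [MeasurableSpace Y]
    (f g : BMFunSub X Y) : Prop := {x : X | f.1 x = g.1 x} ∈ residual X

/-- `B(X,Y)`: Baire measurable functions modulo equality on a comeager set. -/
abbrev BFun (X Y : Type*) [TopologicalSpace X] [MeasurableSpace Y] :=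
  Quot (BFunRel (X := X) (Y := Y))

/-- `[U, A]`: the classes of functions `f` with `U ∖ f⁻¹(A)` meager. -/
def forceSet {X Y : Type*} [TopologicalSpace X] [MeasurableSpace Y]
    (U : Set X) (A : Set Y) : Set (BFun X Y) :=
  {F | ∃ f : BMFunSub X Y, Quot.mk BFunRel f = F ∧ IsMeagre (U \ f.1 ⁻¹' A)}

/-- `Σ(X,Y)`: the σ-algebra generated by the sets `[U, A]` for `U` nonempty open
and `A` Borel. -/
def SigmaXY (X Y : Type*) [TopologicalSpace X] [MeasurableSpace Y] :
    MeasurableSpace (BFun X Y) :=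
  MeasurableSpace.generateFrom
    {S | ∃ (U : Set X) (A : Set Y), IsOpen U ∧ U.Nonempty ∧ MeasurableSet A ∧ S = forceSet U A}

/-! ### A free action in which nonempty open sets are syndetic -/

/-- The greedy algorithm properly `3`-colors the graph of a fixed-point free permutation. -/
theorem exists_three_coloring {G : Type*} [Countable G] (σ : Equiv.Perm G)
    (hσ : ∀ x, σ x ≠ x) : ∃ c : G → Fin 3, ∀ x, c (σ x) ≠ c x := by
  obtain ⟨e, he⟩ := exists_injective_nat G
  have hp : ∀ a b : Fin 3, ∃ c, c ≠ a ∧ c ≠ b := by decide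
  choose p hpa hpb using hp
  let step : (x : G) → ((y : G) → e y < e x → Fin 3) → Fin 3 := fun x c =>
    p (if h : e (σ x) < e x then c (σ x) h else 0)
      (if h : e (σ.symm x) < e x then c (σ.symm x) h else 0)
  have wf : WellFounded fun y x : G => e y < e x := (measure e).wf
  have hfix : ∀ x, wf.fix step x = step x fun y _ => wf.fix step y := wf.fix_eq step
  refine ⟨wf.fix step, fun x hx => ?_⟩
  rcases lt_trichotomy (e (σ x)) (e x) with h | h | h
  · have := hpa (if h : e (σ x) < e x then wf.fix step (σ x) else 0)
      (if h : e (σ.symm x) < e x then wf.fix step (σ.symm x) else 0)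
    rw [dif_pos h, hx] at this
    apply this
    conv_rhs => rw [hfix x]
    simp only [step, dif_pos h, hx]
  · exact hσ x (he h)
  · have h' : e (σ.symm (σ x)) < e (σ x) := by simpa using h
    have := hpb (if h : e (σ (σ x)) < e (σ x) then wf.fix step (σ (σ x)) else 0)
      (if h : e (σ.symm (σ x)) < e (σ x) then wf.fix step (σ.symm (σ x)) else 0)
    rw [dif_pos h'] at this
    apply this
    have hs : wf.fix step (σ.symm (σ x)) = wf.fix step (σ x) := by
      rw [Equiv.symm_apply_apply, hx]
    conv_rhs => rw [hs, hfix (σ x)]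
    simp only [step, dif_pos h']

/-- A nonempty closed invariant subset of a compact space contains a minimal one. -/
theorem exists_minimal_closed_invariant {Y ι : Type*} [TopologicalSpace Y] [CompactSpace Y]
    (a : ι → Y → Y) (Z : Set Y) (hZ : IsClosed Z) (hne : Z.Nonempty)
    (hinv : ∀ i, MapsTo (a i) Z Z) :
    ∃ M ⊆ Z, IsClosed M ∧ M.Nonempty ∧ (∀ i, MapsTo (a i) M M) ∧
      ∀ C ⊆ M, IsClosed C → C.Nonempty → (∀ i, MapsTo (a i) C C) → C = M := by
  obtain ⟨M, hMZ, hM⟩ := zorn_superset_nonempty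
    {C : Set Y | IsClosed C ∧ C.Nonempty ∧ ∀ i, MapsTo (a i) C C}
    (fun c hc hchain hcne => by
      refine ⟨⋂₀ c, ⟨isClosed_sInter fun t ht => (hc ht).1, ?_, fun i x hx t ht =>
        (hc ht).2.2 i (hx t ht)⟩, fun s hs => sInter_subset_of_mem hs⟩
      have : Nonempty c := hcne.to_subtype
      refine IsCompact.nonempty_sInter_of_directed_nonempty_isCompact_isClosed ?_
        (fun t ht => (hc ht).2.1) (fun t ht => (hc ht).1.isCompact) fun t ht => (hc ht).1
      exact fun s hs t ht => (hchain.total hs ht).elim (fun h => ⟨s, hs, Subset.rfl, h⟩)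
        fun h => ⟨t, ht, h, Subset.rfl⟩) Z ⟨hZ, hne, hinv⟩
  refine ⟨M, hMZ, hM.prop.1, hM.prop.2.1, hM.prop.2.2, fun C hCM hC hCne hCinv => ?_⟩
  exact hCM.antisymm (hM.le_of_le ⟨hC, hCne, hCinv⟩ hCM)

/-- Every countable group acts freely and continuously on a nonempty Polish space so that finitely
many translates of any nonempty open set cover the space. -/
theorem exists_free_syndetic_action (Γ : Type*) [Group Γ] [Countable Γ] :
    ∃ α : FreePolishAction Γ, letI := α.ts
      Nonempty α.X ∧ ∀ U : Set α.X, IsOpen U → U.Nonempty →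
        ∃ T : Finset Γ, ∀ x, ∃ t ∈ T, α.smul t x ∈ U := by
  let G : Type := Shrink.{0} Γ
  have : Countable G := (equivShrink.{0} Γ).symm.injective.countable
  let μ : Γ ≃* G := (Shrink.mulEquiv.{0} (α := Γ)).symm
  let a : Γ → (G → G → Fin 3) → (G → G → Fin 3) := fun γ w g δ => w g (δ * μ γ)
  have ha_cont : ∀ γ, Continuous (a γ) := fun γ => by fun_prop
  have ha_mul : ∀ γ δ w, a (γ * δ) w = a γ (a δ w) := fun γ δ w => by
    funext g x; simp [a, mul_assoc]
  have ha_one : ∀ w, a 1 w = w := fun w => by funext g x; simp [a]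
  let Z : Set (G → G → Fin 3) := {w | ∀ g, g ≠ 1 → ∀ δ, w g (g * δ) ≠ w g δ}
  have hZ : IsClosed Z := by
    simp only [Z, ofPred_forall]
    refine isClosed_iInter fun g => isClosed_iInter fun _ => isClosed_iInter fun δ => ?_
    have hc : Continuous fun w : G → G → Fin 3 => (w g (g * δ), w g δ) := by fun_prop
    exact (isClosed_discrete {p : Fin 3 × Fin 3 | p.1 ≠ p.2}).preimage hc
  have hZne : Z.Nonempty := by
    have : ∀ g : G, ∃ c : G → Fin 3, g ≠ 1 → ∀ δ, c (g * δ) ≠ c δ := fun g => by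
      by_cases hg : g = 1
      · exact ⟨0, fun h => absurd hg h⟩
      · obtain ⟨c, hc⟩ := exists_three_coloring (Equiv.mulLeft g) (by simpa using hg)
        exact ⟨c, fun _ => hc⟩
    choose c hc using this
    exact ⟨c, hc⟩
  have hZinv : ∀ γ, MapsTo (a γ) Z Z := fun γ w hw g hg δ => by
    simpa [a, mul_assoc] using hw g hg (δ * μ γ)
  have hFin : PolishSpace (Fin 3) :=
    (Topology.IsClosedEmbedding.of_continuous_injective_isClosedMap continuous_of_discreteTopology
      Fin.val_injective fun s _ => isClosed_discrete (Fin.val '' s)).polishSpace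
  obtain ⟨M, hMZ, hM, hMne, hMinv, hMmin⟩ := exists_minimal_closed_invariant a Z hZ hZne hZinv
  let α : FreePolishAction Γ :=
    { X := M
      ts := inferInstance
      polish := hM.polishSpace
      smul := fun γ x => ⟨a γ x, hMinv γ x.2⟩
      one_smul' := fun x => Subtype.ext (ha_one x)
      mul_smul' := fun γ δ x => Subtype.ext (ha_mul γ δ x)
      cont := fun γ => ((ha_cont γ).comp continuous_subtype_val).subtype_mk _
      free := fun γ x hx => by
        by_contra hγ
        have h1 : μ γ ≠ 1 := by simpa using hγ
        apply hMZ x.2 (μ γ) h1 1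
        have := congrFun (congrFun (congrArg Subtype.val hx) (μ γ)) 1
        simpa [a] using this }
  refine ⟨α, hMne.to_subtype, fun U hU hUne => ?_⟩
  change Set M at U
  have hcomp : CompactSpace M := isCompact_iff_compactSpace.1 hM.isCompact
  have hcover : ∀ x : M, ∃ γ, α.smul γ x ∈ U := by
    by_contra! hcon
    obtain ⟨x, hx⟩ := hcon
    have hclosed : IsClosed {y : M | ∀ γ, α.smul γ y ∉ U} := by
      simp only [ofPred_forall]
      exact isClosed_iInter fun γ => hU.isClosed_compl.preimage (α.cont γ)
    obtain ⟨u, hu⟩ := hUne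
    have := hMmin (Subtype.val '' {y : M | ∀ γ, α.smul γ y ∉ U}) (by simp)
      (hM.isClosedEmbedding_subtypeVal.isClosedMap _ hclosed) ⟨_, x, hx, rfl⟩ (by
        rintro γ _ ⟨y, hy, rfl⟩
        exact ⟨α.smul γ y, fun δ => by rw [← α.mul_smul']; exact hy _, rfl⟩)
    obtain ⟨y, hy, hyu⟩ := this.symm.subset (show (u : M).1 ∈ M from (u : M).2)
    obtain rfl : y = u := Subtype.ext hyu
    exact hy 1 (by rw [α.one_smul']; exact hu)
  obtain ⟨T, hT⟩ := isCompact_univ.elim_finite_subcover (fun γ => α.smul γ ⁻¹' U)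
    (fun γ => hU.preimage (α.cont γ)) fun x _ => mem_iUnion.2 (hcover x)
  exact ⟨T, fun x => by simpa using hT (mem_univ x)⟩

/-! ### A subshift forcing color classes to be non-syndetic -/

/-- Reading a color as a pair `(k, j)`, at a point of color `(k, j)` all the points
`g i * g j * δ` with `i ≤ k` have first coordinate larger than `k`. -/
def gapSubshift [Group Γ] (g : ℕ → Γ) : Set (Γ → ℕ) :=
  {ω | ∀ δ : Γ, ∀ i ≤ (ω δ).unpair.1,
    (ω δ).unpair.1 < (ω (g i * g (ω δ).unpair.2 * δ)).unpair.1}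

theorem isSubshift_gapSubshift [Group Γ] (g : ℕ → Γ) : IsSubshift (gapSubshift g) := by
  constructor
  · have : gapSubshift g = ⋂ (δ : Γ) (m : ℕ) (i : ℕ), {ω : Γ → ℕ | ω δ = m → i ≤ m.unpair.1 →
        m.unpair.1 < (ω (g i * g m.unpair.2 * δ)).unpair.1} := by
      ext ω
      simp only [gapSubshift, mem_ofPred_eq, mem_iInter]
      exact ⟨fun h δ m i hm => by subst hm; exact h δ i, fun h δ i => h δ _ i rfl⟩
    rw [this]
    refine isClosed_iInter fun δ => isClosed_iInter fun m => isClosed_iInter fun i => ?_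
    have hc : Continuous fun ω : Γ → ℕ => (ω δ, ω (g i * g m.unpair.2 * δ)) := by fun_prop
    exact (isClosed_discrete {p : ℕ × ℕ | p.1 = m → i ≤ m.unpair.1 →
      m.unpair.1 < p.2.unpair.1}).preimage hc
  · intro γ ω hω δ i hi
    simpa [shift, mul_assoc] using hω (δ * γ) i hi

/-- Along an element of `gapSubshift g`, the first coordinates are unbounded. -/
theorem exists_le_of_mem_gapSubshift [Group Γ] {g : ℕ → Γ} {ω : Γ → ℕ}
    (hω : ω ∈ gapSubshift g) (N : ℕ) : ∃ δ, N ≤ (ω δ).unpair.1 := by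
  induction N with
  | zero => exact ⟨1, Nat.zero_le _⟩
  | succ N ih =>
    obtain ⟨δ, hδ⟩ := ih
    exact ⟨_, hδ.trans_lt (hω δ 0 (Nat.zero_le _))⟩

/-- No color is syndetic along an element of `gapSubshift g`. -/
theorem exists_forall_ne_of_mem_gapSubshift [Group Γ] {g : ℕ → Γ} (hg : Surjective g)
    {ω : Γ → ℕ} (hω : ω ∈ gapSubshift g) (n : ℕ) (T : Finset Γ) :
    ∃ δ, ∀ t ∈ T, ω (t * δ) ≠ n := by
  choose s hs using hg
  obtain ⟨δ, hδ⟩ := exists_le_of_mem_gapSubshift hω (max n.unpair.1 (T.sup s))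
  refine ⟨g (ω δ).unpair.2 * δ, fun t ht htn => ?_⟩
  have := hω δ (s t) ((Finset.le_sup ht).trans ((le_max_right _ _).trans hδ))
  rw [hs, mul_assoc, htn] at this
  exact absurd ((le_max_left _ _).trans hδ) this.not_ge

/-- `j` indexes a `g`-ball around `g j * δ`, of radius the color of `δ`, on which all colors exceed
the color of `δ`. -/
def HasGap [Group Γ] (g : ℕ → Γ) (ω : Γ → ℕ) (δ : Γ) (j : ℕ) : Prop :=
  ∀ i ≤ ω δ, ω δ < ω (g i * g j * δ)

theorem isOpen_hasGap [Group Γ] (g : ℕ → Γ) (δ : Γ) (j : ℕ) :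
    IsOpen {ω : Γ → ℕ | HasGap g ω δ j} := by
  have : {ω : Γ → ℕ | HasGap g ω δ j} = ⋃ m : ℕ, {ω | ω δ = m} ∩
      ⋂ i ∈ Iic m, {ω | m < ω (g i * g j * δ)} := by
    ext ω
    simp [HasGap]
  rw [this]
  refine isOpen_iUnion fun m => IsOpen.inter ?_ ((finite_Iic m).isOpen_biInter fun i _ => ?_)
  · exact (isOpen_discrete ({m} : Set ℕ)).preimage (continuous_apply (A := fun _ : Γ => ℕ) δ)
  · exact (isOpen_discrete (Ioi m)).preimage
      (continuous_apply (A := fun _ : Γ => ℕ) (g i * g j * δ))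

theorem dense_exists_hasGap [Group Γ] [Infinite Γ] {g : ℕ → Γ} (hg : Surjective g) (δ : Γ) :
    Dense {ω : Γ → ℕ | ∃ j, HasGap g ω δ j} := by
  classical
  refine dense_iff_inter_open.2 fun U hU ⟨ω, hω⟩ => ?_
  obtain ⟨S, u, hu, hSU⟩ := isOpen_pi_iff.1 hU ω hω
  obtain ⟨h, hh⟩ := ((Finset.range (ω δ + 1) ×ˢ insert δ S).image
    fun p => (g p.1)⁻¹ * p.2 * δ⁻¹).exists_notMem
  obtain ⟨j, rfl⟩ := hg h
  refine ⟨fun γ => if γ ∈ insert δ S then ω γ else ω δ + 1, hSU fun γ hγ => ?_, j,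
    fun i hi => ?_⟩
  · have hγ' : γ ∈ insert δ S := Finset.mem_insert_of_mem hγ
    simpa only [if_pos hγ'] using (hu γ hγ).2
  · simp only [Finset.mem_insert_self, if_true] at hi ⊢
    rw [if_neg]
    · exact Nat.lt_succ_self _
    · intro hmem
      refine hh (Finset.mem_image.2 ⟨(i, g i * g j * δ), Finset.mem_product.2
        ⟨Finset.mem_range.2 (Nat.lt_succ_of_le hi), hmem⟩, ?_⟩)
      group

theorem baireMFun_of_measurable {X Y : Type*} [TopologicalSpace X] [MeasurableSpace X]
    [BorelSpace X] [MeasurableSpace Y] {f : X → Y} (hf : Measurable f) : BaireMFun f := by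
  intro B hB
  obtain ⟨U, hU, hBU⟩ := (hf hB).residualEq_isOpen
  refine ⟨U, hU, ?_⟩
  filter_upwards [hBU] with x hx
  have hx' : x ∈ f ⁻¹' B ↔ x ∈ U := iff_of_eq hx
  simp only [mem_compl_iff, mem_symmDiff]
  tauto

/-- The generic point of the shift can be recolored into `gapSubshift g`. -/
theorem shiftHasBMColoring_gapSubshift [Group Γ] [Countable Γ] [Infinite Γ] {g : ℕ → Γ}
    (hg : Surjective g) : ShiftHasBMColoring Γ (gapSubshift g) := by
  classical
  let p : (Γ → ℕ) → ℕ → Prop := fun ω j => HasGap g ω 1 j ∨ ∀ j', ¬ HasGap g ω 1 j'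
  have hp : ∀ ω, ∃ j, p ω j := fun ω => by
    by_cases h : ∃ j, HasGap g ω 1 j
    · exact h.imp fun j => Or.inl
    · exact ⟨0, Or.inr (not_exists.1 h)⟩
  have hgap : ∀ j, MeasurableSet {ω : Γ → ℕ | HasGap g ω 1 j} := fun j =>
    (isOpen_hasGap g 1 j).measurableSet
  have hpm : ∀ j, MeasurableSet {ω | p ω j} := fun j =>
    (hgap j).union (s₂ := {ω | ∀ j', ¬ HasGap g ω 1 j'}) (by
      simp only [ofPred_forall]
      exact MeasurableSet.iInter fun j' => (hgap j').compl)
  have hfind : Measurable fun ω => Nat.find (hp ω) := measurable_find hp hpm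
  have hpair : Measurable fun q : ℕ × ℕ => Nat.pair q.1 q.2 := measurable_of_countable _
  refine ⟨fun ω => Nat.pair (ω 1) (Nat.find (hp ω)),
    baireMFun_of_measurable (hpair.comp ((measurable_pi_apply 1).prodMk hfind)), ?_⟩
  have hres : ∀ δ : Γ, ∀ᶠ ω in residual (Γ → ℕ), ∃ j, HasGap g ω δ j := fun δ => by
    refine residual_of_dense_open ?_ (dense_exists_hasGap hg δ)
    simp only [ofPred_exists]
    exact isOpen_iUnion fun j => isOpen_hasGap g δ j
  filter_upwards [eventually_countable_forall.2 hres] with ω hω δ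
  obtain ⟨j, hj⟩ := hω δ
  have hshift : ∀ j, HasGap g (shift δ ω) 1 j ↔ HasGap g ω δ j := fun j => by
    simp [HasGap, shift]
  have hspec : HasGap g ω δ (Nat.find (hp (shift δ ω))) := by
    rcases Nat.find_spec (hp (shift δ ω)) with h | h
    · exact (hshift _).1 h
    · exact absurd ((hshift j).2 hj) (h j)
  simpa [shift, HasGap] using hspec

/-- An action all of whose nonempty open sets are syndetic has no Baire measurable coloring by a
subshift none of whose elements has a syndetic color. -/
theorem FreePolishAction.not_hasBMCol [Group Γ] [Countable Γ] (α : FreePolishAction Γ)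
    (hne : Nonempty α.X)
    (hα : letI := α.ts
      ∀ U : Set α.X, IsOpen U → U.Nonempty → ∃ T : Finset Γ, ∀ x, ∃ t ∈ T, α.smul t x ∈ U)
    {Ω : Set (Γ → ℕ)}
    (hΩ : ∀ ω ∈ Ω, ∀ (n : ℕ) (T : Finset Γ), ∃ δ, ∀ t ∈ T, ω (t * δ) ≠ n) :
    ¬ α.HasBMCol Ω := by
  let := α.ts
  have := α.polish
  rintro ⟨f, hf, hres⟩
  choose U hU hfU using fun n : ℕ => hf {n} (measurableSet_singleton n)
  let h : Γ → α.X ≃ₜ α.X := fun γ =>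
    { toFun := α.smul γ
      invFun := α.smul γ⁻¹
      left_inv := fun x => by rw [← α.mul_smul', inv_mul_cancel, α.one_smul']
      right_inv := fun x => by rw [← α.mul_smul', mul_inv_cancel, α.one_smul']
      continuous_toFun := α.cont γ
      continuous_invFun := α.cont γ⁻¹ }
  have hgen : ∀ (n : ℕ) (γ : Γ), ∀ᶠ x in residual α.X,
      α.smul γ x ∉ symmDiff (f ⁻¹' {n}) (U n) := fun n γ =>
    (tendsto_residual_of_isOpenMap (h γ).continuous (h γ).isOpenMap).eventually (hfU n)
  have hgen' := eventually_countable_forall.2 fun n => eventually_countable_forall.2 (hgen n)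
  obtain ⟨x, hxΩ, hx⟩ := (dense_of_mem_residual (Filter.inter_mem hres hgen')).nonempty
  have hiff : ∀ n γ, f (α.smul γ x) = n ↔ α.smul γ x ∈ U n := fun n γ => by
    have := hx n γ
    simp only [mem_symmDiff, mem_preimage, mem_singleton_iff] at this
    tauto
  obtain ⟨T, hT⟩ := hα (U (f (α.smul 1 x))) (hU _) ⟨_, (hiff _ 1).1 rfl⟩
  obtain ⟨δ, hδ⟩ := hΩ _ hxΩ (f (α.smul 1 x)) T
  obtain ⟨t, ht, htU⟩ := hT (α.smul δ x)
  rw [← α.mul_smul'] at htU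
  exact hδ t ht ((hiff _ _).2 htU)

/-- There are a free continuous action `α` of `Γ` on a Polish space and a subshift `Ω`
such that the shift action admits a Baire measurable `Ω`-coloring but `α` does not. -/
theorem stmt18 (Γ : Type*) [Group Γ] [Countable Γ] [Infinite Γ] :
    ∃ (α : FreePolishAction Γ) (Ω : Set (Γ → ℕ)), IsSubshift Ω ∧
      ShiftHasBMColoring Γ Ω ∧ ¬ α.HasBMCol Ω := by
  obtain ⟨α, hne, hα⟩ := exists_free_syndetic_action Γ
  obtain ⟨g, hg⟩ := exists_surjective_nat Γ
  exact ⟨α, gapSubshift g, isSubshift_gapSubshift g, shiftHasBMColoring_gapSubshift hg,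
    α.not_hasBMCol hne hα fun _ hω => exists_forall_ne_of_mem_gapSubshift hg hω⟩

end DescColor
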